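/- Let 𝒜 be a symmetric W-tensor of even order m and dimension n, with W-tensor decomposition data: index sets Γ_1,…,Γ_s and subtensors 𝒜_{Γ_1},…,𝒜_{Γ_s} satisfying conditions (i)–(iii) of the definition of a W-tensor. Set f(x) = −𝒜x^m. If f(x) ≥ 0 for all x ∈ ℝ^n, then there exist polynomials h_l in the variables x_{Γ_l} (l = 1,…,s) and real numbers ρ_i^l (i ∈ Γ_l, l = 1,…,s) such that: each h_l is a sums-of-squares polynomial with h_l(x_{Γ_l}) = −𝒜_{Γ_l} x_{Γ_l}^m + Σ_{i∈Γ_l} ρ_i^l x_i^m; for each i = 1,…,n, Σ_{l ∈ Λ(i)} ρ_i^l = 0 where Λ(i) = {l ∈ {1,…,s} : i ∈ Γ_l}; and f(x) = h_1(x_{Γ_1}) + ⋯ + h_s(x_{Γ_s}) for all x ∈ ℝ^n. -/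

import Mathlib

open MvPolynomial Finset

noncomputable section

/-- `tmul A x = 𝒜 x^m`, the homogeneous form associated with an
`m`-th order `n`-dimensional tensor `A`. -/
def tmul {m n : ℕ} (A : (Fin m → Fin n) → ℝ) (x : Fin n → ℝ) : ℝ :=
  ∑ g : Fin m → Fin n, A g * ∏ j, x (g j)

/-- A tensor is symmetric if its entries are invariant under permutations of the indices. -/
def IsSymT {m n : ℕ} (A : (Fin m → Fin n) → ℝ) : Prop :=
  ∀ (σ : Equiv.Perm (Fin m)) (g : Fin m → Fin n), A (g ∘ σ) = A g

/-- `lam` is an H-eigenvalue of a tensor of order `m + 1`: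
there is a nonzero `x` with `𝒜 x^m = lam * x^{[m]}`. -/
def IsHEig {m n : ℕ} (A : (Fin (m + 1) → Fin n) → ℝ) (lam : ℝ) : Prop :=
  ∃ x : Fin n → ℝ, x ≠ 0 ∧ ∀ i : Fin n,
    (∑ g : Fin m → Fin n, A (Fin.cons i g) * ∏ j, x (g j)) = lam * x i ^ m

/-- `𝒜_Γ x_Γ^m` for a subtensor `B` indexed by an index set `Γ ⊆ {1,…,n}`. -/
def subTmul {m n : ℕ} (Γ : Finset (Fin n)) (B : (Fin m → Γ) → ℝ) (x : Fin n → ℝ) : ℝ :=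
  ∑ g : Fin m → Γ, B g * ∏ j, x (g j).1

/-- An index tuple is off-diagonal if not all of its entries coincide. -/
def NotDiag {m : ℕ} {I : Type*} (g : Fin m → I) : Prop := ¬ ∀ j j' : Fin m, g j = g j'

/-- Condition (iii) in the definition of a W-tensor, for one subtensor. -/
def WCondIII {m n : ℕ} {Γ : Finset (Fin n)} (B : (Fin m → Γ) → ℝ) : Prop :=
  (∃ gb : Fin m → Γ, NotDiag gb ∧ ∀ g : Fin m → Γ, NotDiag g →
      (∀ σ : Equiv.Perm (Fin m), g ≠ gb ∘ σ) → B g = 0) ∨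
  (∀ g : Fin m → Γ, NotDiag g → 0 ≤ B g)

/-- Condition (i) in the definition of a W-tensor. -/
def WCondI {n s : ℕ} (Γ : Fin s → Finset (Fin n)) : Prop :=
  ∀ p : Fin s, 0 < (p : ℕ) →
    (((Finset.univ.filter fun l => l < p).biUnion Γ) ∩ Γ p).card ≤ 1

/-- W-tensor. -/
def IsWTensor {m n : ℕ} (A : (Fin m → Fin n) → ℝ) : Prop :=
  ∃ (s : ℕ) (Γ : Fin s → Finset (Fin n)) (B : ∀ l : Fin s, (Fin m → Γ l) → ℝ),
    0 < s ∧ s ≤ n ∧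
    Function.Injective Γ ∧
    Finset.univ.biUnion Γ = Finset.univ ∧
    WCondI Γ ∧
    (∀ x : Fin n → ℝ, tmul A x = ∑ l, subTmul (Γ l) (B l) x) ∧
    (∀ l, WCondIII (B l))

/-- Sums of squares of polynomials. -/
def IsSOSPoly {σ : Type*} (p : MvPolynomial σ ℝ) : Prop :=
  ∃ (r : ℕ) (q : Fin r → MvPolynomial σ ℝ), p = ∑ j, q j ^ 2

/-- The polynomial `𝒜 x^m` as a formal multivariate polynomial. -/
def tpoly {m n : ℕ} (A : (Fin m → Fin n) → ℝ) : MvPolynomial (Fin n) ℝ :=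
  ∑ g : Fin m → Fin n, MvPolynomial.C (A g) * ∏ j, MvPolynomial.X (g j)

/-- The polynomial `𝒜_Γ x_Γ^m` of a subtensor, in the variables `x_Γ`. -/
def subTpoly {m n : ℕ} (Γ : Finset (Fin n)) (B : (Fin m → Γ) → ℝ) : MvPolynomial Γ ℝ :=
  ∑ g : Fin m → Γ, MvPolynomial.C (B g) * ∏ j, MvPolynomial.X (g j)

/-- A (symmetric) tensor is copositive if `𝒜 x^m ≥ 0` for all entrywise-nonnegative `x`. -/
def Copositive {m n : ℕ} (A : (Fin m → Fin n) → ℝ) : Prop :=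
  ∀ x : Fin n → ℝ, (∀ i, 0 ≤ x i) → 0 ≤ tmul A x


section SumsOfSquares

theorem IsSumSq.isSOSPoly {σ : Type*} {p : MvPolynomial σ ℝ} (hp : IsSumSq p) : IsSOSPoly p := by
  induction hp with
  | zero => exact ⟨0, Fin.elim0, by simp⟩
  | sq_add a _ ih =>
    obtain ⟨r, q, hq⟩ := ih
    exact ⟨r + 1, Fin.cons a q, by simp [Fin.sum_univ_succ, hq, sq]⟩

theorem IsSumSq.map_ringHom {R S : Type*} [CommRing R] [CommRing S] (φ : R →+* S) {p : R}
    (hp : IsSumSq p) : IsSumSq (φ p) := by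
  induction hp with
  | zero => simp
  | sq_add a _ ih => simpa using (IsSumSq.mul_self (φ a)).add ih

theorem IsSumSq.smul_of_nonneg {R : Type*} [CommRing R] [Algebra ℝ R] {c : ℝ} (hc : 0 ≤ c) {p : R}
    (hp : IsSumSq p) : IsSumSq (c • p) := by
  rw [Algebra.smul_def, ← Real.mul_self_sqrt hc, map_mul]
  exact (IsSumSq.mul_self _).mul hp

theorem IsSumSq.pow {R : Type*} [CommRing R] {p : R} (hp : IsSumSq p) (k : ℕ) :
    IsSumSq (p ^ k) := by
  simpa using IsSumSq.prod (I := Finset.range k) (x := fun _ => p) fun _ _ => hp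

theorem isSumSq_pow_sub_pow_mul_sub {R : Type*} [CommRing R] {y z : R} (hy : IsSumSq y)
    (hz : IsSumSq z) (k : ℕ) : IsSumSq ((y ^ k - z ^ k) * (y - z)) := by
  rw [← (Commute.all y z).geom_sum₂_mul, mul_assoc]
  exact (IsSumSq.sum fun i _ => (hy.pow _).mul (hz.pow _)).mul (IsSumSq.mul_self _)

/-- The arithmetic-geometric mean inequality for sums of squares, with a sum of squares
certificate. -/
theorem isSumSq_sum_pow_card_sub_prod {R ι : Type*} [CommRing R] [Algebra ℝ R] [DecidableEq ι]
    {y : ι → R} (hy : ∀ i, IsSumSq (y i)) (k : ℕ) (s : Finset ι) (hs : s.card = k) :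
    IsSumSq (∑ i ∈ s, y i ^ k - (k : R) * ∏ i ∈ s, y i) := by
  induction k generalizing s with
  | zero => simp [Finset.card_eq_zero.mp hs]
  | succ k ih =>
    rcases Nat.eq_zero_or_pos k with rfl | hk
    · obtain ⟨a, rfl⟩ := Finset.card_eq_one.mp hs
      simp
    have h₁ : IsSumSq (∑ j ∈ s, y j * (∑ i ∈ s.erase j, y i ^ k
        - (k : R) * ∏ i ∈ s.erase j, y i)) :=
      IsSumSq.sum fun j hj => (hy j).mul (ih _ (by rw [Finset.card_erase_of_mem hj, hs]; rfl))
    have h₂ : IsSumSq ((2⁻¹ : ℝ) • ∑ j ∈ s, ∑ i ∈ s, (y i ^ k - y j ^ k) * (y i - y j)) :=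
      IsSumSq.smul_of_nonneg (by norm_num) <|
        IsSumSq.sum fun j _ => IsSumSq.sum fun i _ =>
          isSumSq_pow_sub_pow_mul_sub (hy i) (hy j) k
    have e₁ : ∑ j ∈ s, y j * (∑ i ∈ s.erase j, y i ^ k - (k : R) * ∏ i ∈ s.erase j, y i)
        = (∑ j ∈ s, y j) * (∑ i ∈ s, y i ^ k) - ∑ j ∈ s, y j ^ (k + 1)
          - (k + 1 : R) * (k * ∏ i ∈ s, y i) := by
      have : ∀ j ∈ s, y j * (∑ i ∈ s.erase j, y i ^ k - (k : R) * ∏ i ∈ s.erase j, y i)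
          = y j * (∑ i ∈ s, y i ^ k) - y j ^ (k + 1) - k * ∏ i ∈ s, y i := by
        intro j hj
        rw [← Finset.mul_prod_erase s y hj, ← Finset.add_sum_erase s _ hj]
        ring
      rw [Finset.sum_congr rfl this, Finset.sum_sub_distrib, Finset.sum_sub_distrib,
        ← Finset.sum_mul, Finset.sum_const, hs, nsmul_eq_mul]
      push_cast
      ring
    have e₂ : ∑ j ∈ s, ∑ i ∈ s, (y i ^ k - y j ^ k) * (y i - y j)
        = (2 : ℝ) • ((k + 1 : R) * ∑ j ∈ s, y j ^ (k + 1)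
          - (∑ j ∈ s, y j) * (∑ i ∈ s, y i ^ k)) := by
      have : ∀ j i, (y i ^ k - y j ^ k) * (y i - y j)
          = y i ^ (k + 1) + y j ^ (k + 1) - y j * y i ^ k - y j ^ k * y i := by
        intros; ring
      simp only [this, Finset.sum_sub_distrib, Finset.sum_add_distrib, ← Finset.mul_sum,
        ← Finset.sum_mul, Finset.sum_const, hs, nsmul_eq_mul]
      rw [two_smul]
      push_cast
      ring
    have h₃ := (h₁.add h₂).smul_of_nonneg (inv_nonneg.mpr (Nat.cast_nonneg (α := ℝ) k))
    convert h₃ using 1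
    rw [e₁, e₂, smul_smul, inv_mul_cancel₀ two_ne_zero, one_smul, eq_inv_smul_iff₀ (by positivity),
      Algebra.smul_def, map_natCast]
    push_cast
    ring

/-- Hurwitz's theorem: the arithmetic-geometric mean form of even degree is a sum of squares. -/
theorem isSumSq_sum_pow_sub_prod {R : Type*} [CommRing R] [Algebra ℝ R] {d : ℕ} (hd : Even d)
    (x : Fin d → R) : IsSumSq (∑ j, x j ^ d - (d : R) * ∏ j, x j) := by
  obtain ⟨k, rfl⟩ := hd
  have key : ∀ u : Fin k → R, IsSumSq (∑ j, (u j ^ 2) ^ k - (k : R) * ∏ j, u j ^ 2) := fun u =>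
    isSumSq_sum_pow_card_sub_prod (fun j => (IsSquare.sq (u j)).isSumSq) k Finset.univ (by simp)
  have h := ((key fun j => x (Fin.castAdd k j)).add (key fun j => x (Fin.natAdd k j))).add
    ((IsSumSq.natCast (R := R) k).mul (IsSumSq.mul_self
      (∏ j, x (Fin.castAdd k j) - ∏ j, x (Fin.natAdd k j))))
  refine (congrArg IsSumSq ?_).mpr h
  simp only [Fin.sum_univ_add, Fin.prod_univ_add, Finset.prod_pow, ← pow_mul, ← two_mul]
  push_cast
  ring

theorem isSumSq_weighted_sum_pow_sub_prod {R : Type*} [CommRing R] [Algebra ℝ R] {d : ℕ}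
    (hd : Even d) (hd0 : d ≠ 0) (x : Fin d → R) {w : Fin d → ℝ} (hw : ∀ j, 0 ≤ w j) {a : ℝ}
    (ha : 0 ≤ a) (hwa : ∏ j, (d * w j) = a ^ d) :
    IsSumSq (∑ j, w j • x j ^ d - a • ∏ j, x j) := by
  have hd' : (d : ℝ) ≠ 0 := Nat.cast_ne_zero.mpr hd0
  have h0 : ∀ j, 0 ≤ d * w j := fun j => mul_nonneg d.cast_nonneg (hw j)
  have hroot : ∏ j, (d * w j) ^ (d : ℝ)⁻¹ = a := by
    rw [Real.finsetProd_rpow _ _ fun j _ => h0 j, hwa, Real.pow_rpow_inv_natCast ha hd0]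
  have h := (isSumSq_sum_pow_sub_prod hd fun j => ((d * w j) ^ (d : ℝ)⁻¹) • x j).smul_of_nonneg
    (inv_nonneg.mpr (Nat.cast_nonneg (α := ℝ) d))
  convert h using 1
  rw [eq_inv_smul_iff₀ hd', Finset.prod_smul, hroot]
  simp only [smul_pow, Real.rpow_inv_natCast_pow (h0 _) hd0, smul_sub, Finset.smul_sum, smul_smul]
  congr 1
  rw [Algebra.smul_def, Algebra.smul_def, map_mul, map_natCast]
  ring

end SumsOfSquares

section DiagonalMinusTail

variable {I K : Type*} [Fintype I] [Fintype K]

/-- A coercivity bound for the one-variable logarithmic barrier. -/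
theorem abs_sub_le_mul_exp_sub {ε c : ℝ} (hε : 0 < ε) (hc : 1 ≤ c) (t : ℝ) :
    |t| - 2 / ε ≤ ε * Real.exp (c * t) - t := by
  have hexp := mul_pos hε (Real.exp_pos (c * t))
  have hε' : 0 < 2 / ε := by positivity
  rcases le_total t 0 with ht | ht
  · rw [abs_of_nonpos ht]
    linarith
  · rw [abs_of_nonneg ht]
    have h₁ : t ^ 2 / 2 ≤ Real.exp (c * t) := by
      have h₂ := Real.quadratic_le_exp_of_nonneg ht
      have h₃ : Real.exp t ≤ Real.exp (c * t) := Real.exp_le_exp.mpr (by nlinarith)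
      linarith
    have h₄ : 2 * t ≤ ε * (t ^ 2 / 2) + 2 / ε := by
      have : ε * (t ^ 2 / 2) + 2 / ε - 2 * t = (ε * t - 2) ^ 2 / (2 * ε) := by
        field_simp
        ring
      have : 0 ≤ (ε * t - 2) ^ 2 / (2 * ε) := by positivity
      linarith
    nlinarith [mul_le_mul_of_nonneg_left h₁ hε.le]

/-- The logarithmic barrier of a positive definite form has a minimizer in the open positive
orthant, here parametrized by the exponential. -/
theorem exists_forall_barrier_le {d : ℕ} (hd : d ≠ 0) (τ : K → Fin d → I) (b : I → ℝ) (a : K → ℝ)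
    (h : ∀ x : I → ℝ, 0 ≤ ∑ i, b i * x i ^ d - ∑ k, a k * ∏ j, x (τ k j)) {ε : ℝ} (hε : 0 < ε) :
    ∃ y : I → ℝ, ∀ y' : I → ℝ,
      ∑ i, (b i + ε) * Real.exp (d * y i) - ∑ k, a k * Real.exp (∑ j, y (τ k j)) - ∑ i, y i ≤
      ∑ i, (b i + ε) * Real.exp (d * y' i) - ∑ k, a k * Real.exp (∑ j, y' (τ k j))
        - ∑ i, y' i := by
  have hd1 : (1 : ℝ) ≤ d := by exact_mod_cast Nat.one_le_iff_ne_zero.mpr hd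
  refine Continuous.exists_forall_le (by fun_prop) ?_
  refine Filter.tendsto_atTop_mono (f := fun y : I → ℝ => ‖y‖ - ∑ _i : I, 2 / ε) (fun y => ?_)
    (Filter.tendsto_atTop_add_const_right _ _ (tendsto_norm_cocompact_atTop (E := I → ℝ)))
  have h₁ := h fun i => Real.exp (y i)
  simp only [← Real.exp_sum, ← Real.exp_nat_mul] at h₁
  have h₂ : ‖y‖ ≤ ∑ i, |y i| :=
    (pi_norm_le_iff_of_nonneg (Finset.sum_nonneg fun i _ => abs_nonneg (y i))).mpr fun i =>
      Finset.single_le_sum (f := fun i => |y i|) (fun i _ => abs_nonneg (y i)) (Finset.mem_univ i)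
  have h₃ := Finset.sum_le_sum fun i (_ : i ∈ Finset.univ) => abs_sub_le_mul_exp_sub hε hd1 (y i)
  simp only [Finset.sum_sub_distrib] at h₃
  simp only [add_mul, Finset.sum_add_distrib]
  linarith

theorem sum_tail_le_of_barrier_minimizer [DecidableEq I] {d : ℕ} (τ : K → Fin d → I) (b : I → ℝ)
    (a : K → ℝ) {y : I → ℝ}
    (hy : ∀ y' : I → ℝ,
      ∑ i, b i * Real.exp (d * y i) - ∑ k, a k * Real.exp (∑ j, y (τ k j)) - ∑ i, y i ≤
      ∑ i, b i * Real.exp (d * y' i) - ∑ k, a k * Real.exp (∑ j, y' (τ k j)) - ∑ i, y' i)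
    (i : I) :
    ∑ k, ∑ j, (if τ k j = i then a k * Real.exp (∑ j, y (τ k j)) else 0)
      ≤ d * (b i * Real.exp (d * y i)) := by
  set e : I → ℝ := fun i' => if i' = i then 1 else 0 with he
  have hder : HasDerivAt (fun t : ℝ => ∑ i', b i' * Real.exp (d * (y i' + t * e i'))
        - ∑ k, a k * Real.exp (∑ j, (y (τ k j) + t * e (τ k j))) - ∑ i', (y i' + t * e i'))
      (∑ i', b i' * (Real.exp (d * y i') * (d * e i'))
        - ∑ k, a k * (Real.exp (∑ j, y (τ k j)) * ∑ j, e (τ k j)) - ∑ i', e i') 0 := by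
    have hlin : ∀ i', HasDerivAt (fun t : ℝ => y i' + t * e i') (e i') 0 := fun i' => by
      simpa using ((hasDerivAt_id (0 : ℝ)).mul_const (e i')).const_add (y i')
    refine ((HasDerivAt.fun_sum fun i' _ => ?_).sub (HasDerivAt.fun_sum fun k _ => ?_)).sub
      (HasDerivAt.fun_sum fun i' _ => hlin i')
    · simpa using (((hlin i').const_mul (d : ℝ)).exp.const_mul (b i'))
    · simpa using ((HasDerivAt.fun_sum fun j (_ : j ∈ Finset.univ) =>
        hlin (τ k j)).exp.const_mul (a k))
  have hmin : IsLocalMin (fun t : ℝ => ∑ i', b i' * Real.exp (d * (y i' + t * e i'))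
        - ∑ k, a k * Real.exp (∑ j, (y (τ k j) + t * e (τ k j))) - ∑ i', (y i' + t * e i')) 0 :=
    Filter.Eventually.of_forall fun t => by simpa using hy fun i' => y i' + t * e i'
  have h0 := hmin.hasDerivAt_eq_zero hder
  have e₁ : ∑ i', b i' * (Real.exp (d * y i') * (d * e i')) = d * (b i * Real.exp (d * y i)) := by
    simp [he]
    ring
  have e₂ : ∑ i', e i' = 1 := by simp [he]
  have e₃ : ∑ k, a k * (Real.exp (∑ j, y (τ k j)) * ∑ j, e (τ k j))
      = ∑ k, ∑ j, (if τ k j = i then a k * Real.exp (∑ j, y (τ k j)) else 0) := by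
    simp only [he, Finset.mul_sum, mul_ite, mul_one, mul_zero]
  linarith

theorem exists_weights_of_pos [DecidableEq I] {d : ℕ} (hd : d ≠ 0) (τ : K → Fin d → I) (b : I → ℝ)
    {a : K → ℝ} (ha : ∀ k, 0 ≤ a k)
    (h : ∀ x : I → ℝ, 0 ≤ ∑ i, b i * x i ^ d - ∑ k, a k * ∏ j, x (τ k j)) {ε : ℝ} (hε : 0 < ε) :
    ∃ w : K → Fin d → ℝ, (∀ k j, 0 ≤ w k j) ∧ (∀ k, ∏ j, (d * w k j) = a k ^ d) ∧
      ∀ i, ∑ k, ∑ j, (if τ k j = i then w k j else 0) ≤ b i + ε := by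
  obtain ⟨y, hy⟩ := exists_forall_barrier_le hd τ b a h hε
  have hd' : (d : ℝ) ≠ 0 := Nat.cast_ne_zero.mpr hd
  refine ⟨fun k j => a k * Real.exp (∑ j, y (τ k j)) / (d * Real.exp (d * y (τ k j))),
    fun k j => by have := ha k; positivity, fun k => ?_, fun i => ?_⟩
  · have : ∀ j, d * (a k * Real.exp (∑ j, y (τ k j)) / (d * Real.exp (d * y (τ k j))))
        = a k * Real.exp (∑ j, y (τ k j)) / Real.exp (d * y (τ k j)) := fun j => by
      field_simp
    rw [Finset.prod_congr rfl fun j _ => this j, Finset.prod_div_distrib, Finset.prod_const,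
      Finset.card_univ, Fintype.card_fin, ← Real.exp_sum, ← Finset.mul_sum, Real.exp_nat_mul,
      mul_pow, mul_div_assoc, div_self (by positivity), mul_one]
  · have h₁ := sum_tail_le_of_barrier_minimizer τ (fun i => b i + ε) a hy i
    have h₂ : ∑ k, ∑ j, (if τ k j = i then
          a k * Real.exp (∑ j, y (τ k j)) / (d * Real.exp (d * y (τ k j))) else 0)
        = (∑ k, ∑ j, (if τ k j = i then a k * Real.exp (∑ j, y (τ k j)) else 0))
          / (d * Real.exp (d * y i)) := by
      simp only [Finset.sum_div]
      refine Finset.sum_congr rfl fun k _ => Finset.sum_congr rfl fun j _ => ?_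
      split_ifs with hij
      · rw [hij]
      · simp
    rw [h₂, div_le_iff₀ (by positivity)]
    linarith

theorem exists_weights [DecidableEq I] {d : ℕ} (hd : d ≠ 0) (τ : K → Fin d → I) (b : I → ℝ)
    {a : K → ℝ} (ha : ∀ k, 0 ≤ a k)
    (h : ∀ x : I → ℝ, 0 ≤ ∑ i, b i * x i ^ d - ∑ k, a k * ∏ j, x (τ k j)) :
    ∃ w : K → Fin d → ℝ, (∀ k j, 0 ≤ w k j) ∧ (∀ k, ∏ j, (d * w k j) = a k ^ d) ∧
      ∀ i, ∑ k, ∑ j, (if τ k j = i then w k j else 0) ≤ b i := by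
  choose w hw₀ hw₁ hw₂ using fun N : ℕ =>
    exists_weights_of_pos hd τ b ha h (Nat.one_div_pos_of_nat (α := ℝ) (n := N))
  have hmem : ∀ N, w N ∈ Set.Icc (0 : K → Fin d → ℝ) (fun k j => b (τ k j) + 1) := fun N =>
    ⟨fun k j => hw₀ N k j, fun k j => by
      have hle : w N k j ≤ ∑ k', ∑ j', (if τ k' j' = τ k j then w N k' j' else 0) := by
        have hnn : ∀ k' j', 0 ≤ (if τ k' j' = τ k j then w N k' j' else 0) := fun k' j' => by
          split_ifs
          exacts [hw₀ N k' j', le_rfl]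
        calc w N k j = (if τ k j = τ k j then w N k j else 0) := by simp
          _ ≤ ∑ j', (if τ k j' = τ k j then w N k j' else 0) :=
            Finset.single_le_sum (f := fun j' => if τ k j' = τ k j then w N k j' else 0)
              (fun j' _ => hnn k j') (Finset.mem_univ j)
          _ ≤ _ := Finset.single_le_sum
              (f := fun k' => ∑ j', (if τ k' j' = τ k j then w N k' j' else 0))
              (fun k' _ => Finset.sum_nonneg fun j' _ => hnn k' j') (Finset.mem_univ k)
      have h₂ := hw₂ N (τ k j)
      have h₃ : 1 / ((N : ℝ) + 1) ≤ 1 :=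
        div_le_one_of_le₀ (by linarith [(Nat.cast_nonneg N : (0 : ℝ) ≤ N)]) (by positivity)
      linarith⟩
  obtain ⟨v, -, φ, hφ, hv⟩ := isCompact_Icc.tendsto_subseq hmem
  have hvkj : ∀ k j, Filter.Tendsto (fun N => w (φ N) k j) Filter.atTop (nhds (v k j)) :=
    fun k j => (tendsto_pi_nhds.mp (tendsto_pi_nhds.mp hv k) j)
  refine ⟨v, fun k j => ge_of_tendsto' (hvkj k j) fun N => hw₀ (φ N) k j, fun k => ?_,
    fun i => ?_⟩
  · refine tendsto_nhds_unique (tendsto_finsetProd _ fun j _ => (hvkj k j).const_mul (d : ℝ)) ?_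
    simp only [hw₁]
    exact tendsto_const_nhds
  · have hl : Filter.Tendsto (fun N => ∑ k, ∑ j, (if τ k j = i then w (φ N) k j else 0))
        Filter.atTop (nhds (∑ k, ∑ j, (if τ k j = i then v k j else 0))) :=
      tendsto_finsetSum _ fun k _ => tendsto_finsetSum _ fun j _ => by
        split_ifs
        exacts [hvkj k j, tendsto_const_nhds]
    have hr : Filter.Tendsto (fun N => b i + 1 / ((φ N : ℝ) + 1)) Filter.atTop
        (nhds (b i + 0)) :=
      (tendsto_one_div_add_atTop_nhds_zero_nat.comp hφ.tendsto_atTop).const_add _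
    simpa using le_of_tendsto_of_tendsto' hl hr fun N => hw₂ (φ N) i

/-- A positive semidefinite diagonal minus tail form is a sum of squares. -/
theorem isSumSq_diagonal_sub_tail {d : ℕ} (hd : d ≠ 0) (heven : Even d) (τ : K → Fin d → I)
    (b : I → ℝ) {a : K → ℝ} (ha : ∀ k, 0 ≤ a k)
    (h : ∀ x : I → ℝ, 0 ≤ ∑ i, b i * x i ^ d - ∑ k, a k * ∏ j, x (τ k j)) :
    IsSumSq (∑ i, C (b i) * X i ^ d - ∑ k, C (a k) * ∏ j, X (τ k j) : MvPolynomial I ℝ) := by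
  classical
  obtain ⟨w, hw₀, hw₁, hw₂⟩ := exists_weights hd τ b ha h
  have h₁ : IsSumSq (∑ k, (∑ j, w k j • X (τ k j) ^ d - a k • ∏ j, X (τ k j)) :
      MvPolynomial I ℝ) :=
    IsSumSq.sum fun k _ => isSumSq_weighted_sum_pow_sub_prod heven hd (fun j => X (τ k j))
      (hw₀ k) (ha k) (hw₁ k)
  have h₂ : IsSumSq (∑ i, (b i - ∑ k, ∑ j, (if τ k j = i then w k j else 0)) • X i ^ d :
      MvPolynomial I ℝ) :=
    IsSumSq.sum fun i _ => (heven.isSquare_pow _).isSumSq.smul_of_nonneg (sub_nonneg.mpr (hw₂ i))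
  have e : (∑ i, (∑ k, ∑ j, (if τ k j = i then w k j else 0)) • X i ^ d : MvPolynomial I ℝ)
      = ∑ k, ∑ j, w k j • X (τ k j) ^ d := by
    simp only [Finset.sum_smul]
    rw [Finset.sum_comm]
    refine Finset.sum_congr rfl fun k _ => ?_
    rw [Finset.sum_comm]
    simp [ite_smul]
  refine (congrArg IsSumSq ?_).mpr (h₁.add h₂)
  simp only [sub_smul, Finset.sum_sub_distrib, e]
  simp only [MvPolynomial.smul_eq_C_mul]
  ring

end DiagonalMinusTail

section TreeDecomposition

/-- If two forms `F` and `h` of even degree share at most one variable `x i` and their sum is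
nonnegative, then a multiple of `x i ^ d` can be moved from one to the other so that both become
nonnegative. -/
theorem exists_balance_of_add_nonneg {ι : Type*} {d : ℕ} (hd : d ≠ 0)
    (heven : Even d) {F h : (ι → ℝ) → ℝ}
    (hF : ∀ (t : ℝ) x, F (t • x) = t ^ d * F x) (hh : ∀ (t : ℝ) x, h (t • x) = t ^ d * h x)
    (i : ι) (hglue : ∀ x x' : ι → ℝ, x i = x' i → 0 ≤ F x + h x') :
    ∃ r : ℝ, (∀ x, 0 ≤ F x - r * x i ^ d) ∧ ∀ x, 0 ≤ h x + r * x i ^ d := by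
  have hF0 : F 0 = 0 := by simpa [hd] using hF 0 0
  have hh0 : h 0 = 0 := by simpa [hd] using hh 0 0
  obtain ⟨r, hr₁, hr₂⟩ := exists_between_of_forall_le
    (s := (fun x => -h x) '' {x | x i = 1}) (t := F '' {x | x i = 1})
    ⟨_, fun _ => 1, rfl, rfl⟩ ⟨_, fun _ => 1, rfl, rfl⟩ (by
      rintro _ ⟨x', hx', rfl⟩ _ ⟨x, hx, rfl⟩
      have := hglue x x' (hx.trans hx'.symm)
      linarith)
  refine ⟨r, fun x => ?_, fun x => ?_⟩ <;> by_cases hx : x i = 0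
  · simpa [hx, hd, hh0] using hglue x 0 (by simp [hx])
  · have h₁ : r ≤ F ((x i)⁻¹ • x) := hr₂ ⟨_, by simp [hx], rfl⟩
    have h₂ : F x = x i ^ d * F ((x i)⁻¹ • x) := by
      rw [← hF, smul_smul, mul_inv_cancel₀ hx, one_smul]
    have := mul_le_mul_of_nonneg_left h₁ (heven.pow_nonneg (x i))
    linarith
  · simpa [hx, hd, hF0] using hglue 0 x (by simp [hx])
  · have h₁ : -h ((x i)⁻¹ • x) ≤ r := hr₁ ⟨_, by simp [hx], rfl⟩
    have h₂ : h x = x i ^ d * h ((x i)⁻¹ • x) := by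
      rw [← hh, smul_smul, mul_inv_cancel₀ hx, one_smul]
    have := mul_le_mul_of_nonneg_left h₁ (heven.pow_nonneg (x i))
    linarith

/-- A nonnegative sum of forms of even degree, whose variable sets each meet the union of the
previous ones in at most one variable, splits into nonnegative forms after a redistribution of
diagonal terms. -/
theorem exists_diagonal_redistribution {ι : Type*} [Fintype ι] [DecidableEq ι] {d : ℕ} (hd : d ≠ 0)
    (heven : Even d) (s : ℕ) (Γ : Fin s → Finset ι)
    (hΓ : ∀ p l l' i j, l < p → l' < p → i ∈ Γ l → j ∈ Γ l' → i ∈ Γ p → j ∈ Γ p → i = j)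
    (f : Fin s → (ι → ℝ) → ℝ)
    (hf : ∀ l (t : ℝ) x, f l (t • x) = t ^ d * f l x)
    (hloc : ∀ l x x', (∀ i ∈ Γ l, x i = x' i) → f l x = f l x')
    (hnn : ∀ x, 0 ≤ ∑ l, f l x) :
    ∃ ρ : Fin s → ι → ℝ, (∀ l, ∀ i ∉ Γ l, ρ l i = 0) ∧ (∀ i, ∑ l, ρ l i = 0) ∧
      ∀ l x, 0 ≤ f l x + ∑ i, ρ l i * x i ^ d := by
  induction s with
  | zero => exact ⟨Fin.elim0, fun l => l.elim0, by simp, fun l => l.elim0⟩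
  | succ s ih =>
    have hF : ∀ (t : ℝ) x,
        ∑ l : Fin s, f l.castSucc (t • x) = t ^ d * ∑ l : Fin s, f l.castSucc x := by
      simp [hf, Finset.mul_sum]
    have ih' := ih (fun l => Γ l.castSucc) fun p (l l' : Fin s) i j hl hl' =>
      hΓ _ l.castSucc l'.castSucc i j (by simpa using hl) (by simpa using hl')
    have hglue : ∀ x x', (∀ (l : Fin s), ∀ i ∈ Γ l.castSucc, i ∈ Γ (Fin.last s) → x i = x' i) →
        0 ≤ ∑ l : Fin s, f l.castSucc x + f (Fin.last s) x' := by
      intro x x' hxx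
      have h := hnn fun i => if i ∈ Γ (Fin.last s) then x' i else x i
      rw [Fin.sum_univ_castSucc] at h
      convert h using 2
      · refine Finset.sum_congr rfl fun l _ => hloc _ _ _ fun i hi => ?_
        split_ifs with hi'
        exacts [hxx l i hi hi', rfl]
      · exact hloc _ _ _ fun i hi => by simp [hi]
    by_cases hex : ∃ (l₀ : Fin s) (i₀ : ι), i₀ ∈ Γ l₀.castSucc ∧ i₀ ∈ Γ (Fin.last s)
    · obtain ⟨l₀, i₀, hi₁, hi₂⟩ := hex
      obtain ⟨r, hr₁, hr₂⟩ := exists_balance_of_add_nonneg hd heven hF (hf (Fin.last s)) i₀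
        fun x x' hx => hglue x x' fun l i hi hi' => by
          rw [hΓ (Fin.last s) l.castSucc l₀.castSucc i i₀ l.castSucc_lt_last l₀.castSucc_lt_last
            hi hi₁ hi' hi₂, hx]
      obtain ⟨ρ, hρ₁, hρ₂, hρ₃⟩ := ih'
        (fun l x => f l.castSucc x - (if l = l₀ then r else 0) * x i₀ ^ d)
        (fun l t x => by simp only [hf, Pi.smul_apply, smul_eq_mul, mul_pow]; ring)
        (fun l x x' hx => by
          rw [hloc l.castSucc x x' hx]
          split_ifs with hl
          · rw [hx i₀ (hl ▸ hi₁)]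
          · simp)
        (fun x => by simpa [Finset.sum_sub_distrib, ← Finset.sum_mul] using hr₁ x)
      refine ⟨Fin.snoc (α := fun _ => ι → ℝ)
        (fun l => ρ l - Pi.single i₀ (if l = l₀ then r else 0)) (Pi.single i₀ r), ?_, ?_, ?_⟩
      · refine Fin.lastCases (fun i hi => ?_) (fun l i hi => ?_)
        · have : i ≠ i₀ := fun h => hi (h ▸ hi₂)
          simp [this]
        · have h₁ := hρ₁ l i hi
          rcases eq_or_ne l l₀ with rfl | hl
          · have : i ≠ i₀ := fun h => hi (h ▸ hi₁)
            simp [this, h₁]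
          · simp [hl, h₁]
      · intro i
        rcases eq_or_ne i i₀ with rfl | hi
        · simp [Fin.sum_univ_castSucc, Finset.sum_sub_distrib, hρ₂]
        · simp [Fin.sum_univ_castSucc, hρ₂, hi]
      · refine Fin.lastCases (fun x => ?_) (fun l x => ?_)
        · simpa [Pi.single_apply] using hr₂ x
        · have := hρ₃ l x
          simp only [Fin.snoc_castSucc, Pi.sub_apply, sub_mul, Finset.sum_sub_distrib,
            Pi.single_apply i₀, ite_mul (_ = i₀), zero_mul, Finset.sum_ite_eq', Finset.mem_univ,
            if_true]
          linarith
    · push Not at hex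
      have hF0 : ∑ l : Fin s, f l.castSucc 0 = 0 := by simpa [hd] using hF 0 0
      have hh0 : f (Fin.last s) 0 = 0 := by simpa [hd] using hf (Fin.last s) 0 0
      obtain ⟨ρ, hρ₁, hρ₂, hρ₃⟩ := ih' (fun l => f l.castSucc) (fun l => hf _) (fun l => hloc _)
        fun x => by simpa [hh0] using hglue x 0 fun l i hi hi' => absurd hi' (hex l i hi)
      refine ⟨Fin.snoc (α := fun _ => ι → ℝ) ρ 0, ?_, ?_, ?_⟩
      · exact Fin.lastCases (by simp) (by simpa using hρ₁)
      · simpa [Fin.sum_univ_castSucc] using hρ₂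
      · refine Fin.lastCases (fun x => ?_) (by simpa using hρ₃)
        simpa [hF0] using hglue 0 x fun l i hi hi' => absurd hi' (hex l i hi)

end TreeDecomposition

section Pieces

/-- A positive semidefinite form consisting of a diagonal part and a single further monomial is
a sum of squares. -/
theorem isSumSq_diagonal_add_monomial {I : Type*} [Fintype I] {d : ℕ} (hd : d ≠ 0)
    (heven : Even d) {τ : Fin d → I} (hτ : NotDiag τ) (b : I → ℝ) (a : ℝ)
    (h : ∀ x : I → ℝ, 0 ≤ ∑ i, b i * x i ^ d + a * ∏ j, x (τ j)) :
    IsSumSq (∑ i, C (b i) * X i ^ d + C a * ∏ j, X (τ j) : MvPolynomial I ℝ) := by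
  classical
  rcases le_total a 0 with ha | ha
  · have h₁ := isSumSq_diagonal_sub_tail hd heven (fun _ : Unit => τ) b (a := fun _ => -a)
      (fun _ => by linarith) (by simpa using h)
    simpa using h₁
  by_cases hodd : ∃ i, Odd (Finset.univ.filter fun j => τ j = i).card
  · obtain ⟨i, hi⟩ := hodd
    set e : I → ℝ := fun k => if k = i then -1 else 1 with he
    have hprod : ∏ j, e (τ j) = -1 := by
      simp [he, Finset.prod_ite, hi.neg_one_pow]
    have hpow : ∀ k, e k ^ d = 1 := fun k => by
      simp only [he]
      split_ifs <;> simp [heven.neg_one_pow]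
    have h₁ := isSumSq_diagonal_sub_tail hd heven (fun _ : Unit => τ) b (a := fun _ => a)
      (fun _ => ha) (fun x => by
        simpa [mul_pow, hpow, Finset.prod_mul_distrib, hprod, sub_eq_add_neg] using
          h fun k => e k * x k)
    have h₂ := h₁.map_ringHom
      (aeval fun k => C (e k) * X k : MvPolynomial I ℝ →ₐ[ℝ] MvPolynomial I ℝ).toRingHom
    refine (congrArg IsSumSq ?_).mp h₂
    have hX : ∏ j, C (e (τ j)) * X (τ j) = -∏ j, (X (τ j) : MvPolynomial I ℝ) := by
      rw [Finset.prod_mul_distrib, ← map_prod, hprod]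
      simp
    have hXd : ∀ k, (C (e k) * X k) ^ d = (X k ^ d : MvPolynomial I ℝ) := fun k => by
      rw [mul_pow, ← map_pow, hpow, map_one, one_mul]
    simp only [AlgHom.toRingHom_eq_coe, RingHom.coe_coe, map_sub, map_sum, map_mul, map_prod,
      map_pow, aeval_X, aeval_C, MvPolynomial.algebraMap_eq, hX, hXd]
    simp
  · push Not at hodd
    simp only [Nat.not_odd_iff_even] at hodd
    have hb : ∀ i, 0 ≤ b i := fun i => by
      have hex : ∃ j, τ j ≠ i := by
        by_contra! hcon
        exact hτ fun j j' => (hcon j).trans (hcon j').symm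
      obtain ⟨j, hj⟩ := hex
      have h₁ := h (Pi.single i 1)
      rw [Finset.prod_eq_zero (Finset.mem_univ j) (by simp [hj])] at h₁
      simpa [Pi.single_apply, hd] using h₁
    simp only [← MvPolynomial.smul_eq_C_mul]
    refine (IsSumSq.sum fun i _ => (heven.isSquare_pow _).isSumSq.smul_of_nonneg (hb i)).add
      (IsSumSq.smul_of_nonneg ha ?_)
    rw [Finset.prod_comp (fun i => (X i : MvPolynomial I ℝ)) τ]
    exact IsSumSq.prod fun i _ => ((hodd i).isSquare_pow _).isSumSq

theorem sum_tuples_eq_sum_diagonal_add {I M : Type*} [Fintype I] [DecidableEq I] [AddCommMonoid M]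
    {d : ℕ} [DecidablePred (NotDiag : (Fin d → I) → Prop)] (hd : d ≠ 0) (φ : (Fin d → I) → M) :
    ∑ g, φ g = ∑ i, φ (fun _ => i) + ∑ g with NotDiag g, φ g := by
  have : NeZero d := ⟨hd⟩
  have h : Finset.univ.filter (fun g : Fin d → I => ¬ NotDiag g)
      = Finset.univ.image fun i _ => i := by
    ext g
    simp only [NotDiag, not_not, Finset.mem_filter, Finset.mem_univ, true_and, Finset.mem_image]
    exact ⟨fun hg => ⟨g 0, funext fun j => hg 0 j⟩, by rintro ⟨i, rfl⟩ j j'; rfl⟩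
  rw [← Finset.sum_filter_add_sum_filter_not Finset.univ (fun g : Fin d → I => NotDiag g), h,
    Finset.sum_image fun i _ i' _ hi => congrFun hi 0, add_comm]

theorem isSumSq_neg_subTpoly_add_diagonal {d n : ℕ} (hd : d ≠ 0) (heven : Even d)
    {Γ : Finset (Fin n)} {B : (Fin d → Γ) → ℝ} (hB : WCondIII B) (c : Γ → ℝ)
    (h : ∀ x : Γ → ℝ, 0 ≤ -∑ g, B g * ∏ j, x (g j) + ∑ i, c i * x i ^ d) :
    IsSumSq (-subTpoly Γ B + ∑ i, C (c i) * X i ^ d) := by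
  classical
  have hdiag : -subTpoly Γ B + ∑ i, C (c i) * X i ^ d
      = ∑ i, C (c i - B fun _ => i) * X i ^ d
        - ∑ g with NotDiag g, C (B g) * ∏ j, X (g j) := by
    rw [subTpoly, sum_tuples_eq_sum_diagonal_add hd]
    simp only [Finset.prod_const, Finset.card_univ, Fintype.card_fin, map_sub, sub_mul,
      Finset.sum_sub_distrib]
    ring
  have hdiag' : ∀ x : Γ → ℝ, 0 ≤ ∑ i, (c i - B fun _ => i) * x i ^ d
        - ∑ g with NotDiag g, B g * ∏ j, x (g j) := fun x => by
    have h₁ := congrArg (eval x) hdiag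
    simp only [subTpoly, map_add, map_neg, map_sub, map_sum, map_mul, map_prod, map_pow, eval_C,
      eval_X] at h₁
    simpa only [map_sub, h₁] using h x
  rw [hdiag]
  rcases hB with ⟨τ, hτ, hB⟩ | hB
  · have hmono : ∀ {R : Type} [CommRing R] (ψ : ℝ →+* R) (x : Γ → R),
        ∑ g with NotDiag g, ψ (B g) * ∏ j, x (g j)
          = ψ (∑ g with NotDiag g, B g) * ∏ j, x (τ j) := by
      intro R _ ψ x
      rw [map_sum, Finset.sum_mul]
      refine Finset.sum_congr rfl fun g hg => ?_
      by_cases hgτ : ∃ σ : Equiv.Perm (Fin d), g = τ ∘ σ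
      · obtain ⟨σ, rfl⟩ := hgτ
        congr 1
        exact Equiv.prod_comp σ fun j => x (τ j)
      · push Not at hgτ
        simp [hB g (Finset.mem_filter.mp hg).2 hgτ]
    have h₁ := isSumSq_diagonal_add_monomial hd heven hτ (fun i => c i - B fun _ => i)
      (-∑ g with NotDiag g, B g) fun x => by
        have h₂ := hdiag' x
        have h₃ := hmono (RingHom.id ℝ) x
        simp only [RingHom.id_apply] at h₃
        linarith
    rw [hmono C X]
    simpa [sub_eq_add_neg] using h₁
  · have h₁ := isSumSq_diagonal_sub_tail hd heven (fun g : Fin d → Γ => g)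
      (fun i => c i - B fun _ => i) (a := fun g => if NotDiag g then B g else 0)
      (fun g => by split_ifs with hg; exacts [hB g hg, le_rfl])
      (fun x => by simpa only [Finset.sum_filter, ite_mul, zero_mul] using hdiag' x)
    simpa only [Finset.sum_filter, apply_ite (C : ℝ → MvPolynomial Γ ℝ), map_zero, ite_mul,
      zero_mul] using h₁

end Pieces

/-- Theorem 3.1: structured SOS decomposition for a nonnegative form `f = −𝒜x^m`
induced by an even-order symmetric W-tensor with decomposition data `Γ_l`, `𝒜_{Γ_l}`. -/
theorem theorem31 (m n s : ℕ) (heven : Even (m + 1)) (hspos : 0 < s) (hsn : s ≤ n)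
    (A : (Fin (m + 1) → Fin n) → ℝ) (hsym : IsSymT A)
    (Γ : Fin s → Finset (Fin n)) (B : ∀ l : Fin s, (Fin (m + 1) → Γ l) → ℝ)
    (hinj : Function.Injective Γ)
    (hcover : Finset.univ.biUnion Γ = Finset.univ)
    (hI : WCondI Γ)
    (hII : ∀ x : Fin n → ℝ, tmul A x = ∑ l, subTmul (Γ l) (B l) x)
    (hIII : ∀ l, WCondIII (B l))
    (hnonneg : ∀ x : Fin n → ℝ, 0 ≤ - tmul A x) :
    ∃ ρ : Fin s → Fin n → ℝ,
      (∀ l, IsSOSPoly (- subTpoly (Γ l) (B l)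
          + ∑ i : ↥(Γ l), (MvPolynomial.C (ρ l i.1) * MvPolynomial.X i ^ (m + 1)
              : MvPolynomial ↥(Γ l) ℝ))) ∧
      (∀ i : Fin n, ∑ l ∈ Finset.univ.filter (fun l => i ∈ Γ l), ρ l i = 0) ∧
      (∀ x : Fin n → ℝ,
        - tmul A x = ∑ l, (- subTmul (Γ l) (B l) x + ∑ i ∈ Γ l, ρ l i * x i ^ (m + 1))) := by
  have hd : m + 1 ≠ 0 := m.succ_ne_zero
  obtain ⟨ρ, hρ₁, hρ₂, hρ₃⟩ := exists_diagonal_redistribution hd heven s Γ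
    (by
      intro p l l' i j hl hl' hi hj hip hjp
      refine Finset.card_le_one.mp (hI p ((Nat.zero_le _).trans_lt hl)) i ?_ j ?_
      · exact Finset.mem_inter.mpr ⟨Finset.mem_biUnion.mpr ⟨l, by simpa using hl, hi⟩, hip⟩
      · exact Finset.mem_inter.mpr ⟨Finset.mem_biUnion.mpr ⟨l', by simpa using hl', hj⟩, hjp⟩)
    (fun l x => -subTmul (Γ l) (B l) x)
    (fun l t x => by
      simp only [subTmul, Pi.smul_apply, smul_eq_mul, Finset.prod_mul_distrib, Finset.prod_const,
        Finset.card_univ, Fintype.card_fin, mul_neg, Finset.mul_sum, mul_left_comm])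
    (fun l x x' hx => by
      simp only [subTmul]
      congr! 4 with g _ j _
      exact hx _ (g j).2)
    (fun x => by simpa [hII] using hnonneg x)
  have hsupp : ∀ l (x : Fin n → ℝ),
      ∑ i ∈ Γ l, ρ l i * x i ^ (m + 1) = ∑ i, ρ l i * x i ^ (m + 1) := fun l x =>
    Finset.sum_subset (Finset.subset_univ _) fun i _ hi => by simp [hρ₁ l i hi]
  refine ⟨ρ, fun l => ?_, fun i => ?_, fun x => ?_⟩
  · refine IsSumSq.isSOSPoly
      (isSumSq_neg_subTpoly_add_diagonal hd heven (hIII l) (fun i => ρ l i) fun x => ?_)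
    have h := hρ₃ l fun i => if hi : i ∈ Γ l then x ⟨i, hi⟩ else 0
    rw [← hsupp, ← Finset.sum_coe_sort (Γ l)] at h
    simpa [subTmul] using h
  · rw [← hρ₂ i]
    exact Finset.sum_subset (Finset.filter_subset _ _) fun l _ hl =>
      hρ₁ l i fun hi => hl (by simpa using hi)
  · simp only [hsupp, Finset.sum_add_distrib, hII, Finset.sum_neg_distrib]
    rw [Finset.sum_comm]
    simp [← Finset.sum_mul, hρ₂]

end
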